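/- Let (A,+) be an abelian group and consider the semidirect product A ⋊ Aut(A) (with multiplication (a,f)(b,g) = (a + f(b), f ∘ g)), acting on A by (a,f).c := f(c) + a. Then: (1) if (A,+,·) is a brace with γ(a) : c ↦ c·a + c, the set S := {(a, γ(a)) : a ∈ A} is a regular subgroup of A ⋊ Aut(A); and (2) if S is a regular subgroup of A ⋊ Aut(A), then, writing for each b ∈ A the unique element of S of the form (b, f(b)), the multiplication a · b := f(b)(a) − a makes (A,+,·) a brace. -/

import Mathlib

/-- `(A,+,·)` is a brace. -/
def IsBrace {A : Type*} [AddCommGroup A] (mul : A → A → A) : Prop :=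
  (∀ a b c : A, mul (a + b) c = mul a c + mul b c) ∧
  (∀ a b c : A, mul a (mul b c + b + c) = mul (mul a b) c + mul a b + mul a c) ∧
  (∀ b : A, Function.Bijective (fun a => mul a b + a))
/-- Multiplication of the semidirect product `A ⋊ Aut(A)`:
`(a, f)(b, g) = (a + f(b), f ∘ g)`. -/
def sdMul {A : Type*} [AddCommGroup A] (p q : A × (A ≃+ A)) : A × (A ≃+ A) :=
  (p.1 + p.2 q.1, q.2.trans p.2)

/-- Inversion in the semidirect product `A ⋊ Aut(A)`: `(a, f)⁻¹ = (−f⁻¹(a), f⁻¹)`. -/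
def sdInv {A : Type*} [AddCommGroup A] (p : A × (A ≃+ A)) : A × (A ≃+ A) :=
  (-(p.2.symm p.1), p.2.symm)
/-- `S` is a regular subgroup of `A ⋊ Aut(A)`, acting on `A` by `(a, f).c = f(c) + a`:
it contains the identity, is closed under multiplication and inversion, and for all
`a, b ∈ A` there is a unique `x ∈ S` with `x.a = b`. -/
def IsRegularSubgroup {A : Type*} [AddCommGroup A] (S : Set (A × (A ≃+ A))) : Prop :=
  ((0, AddEquiv.refl A) ∈ S ∧
    (∀ p ∈ S, ∀ q ∈ S, sdMul p q ∈ S) ∧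
    (∀ p ∈ S, sdInv p ∈ S)) ∧
  ∀ a b : A, ∃! x : A × (A ≃+ A), x ∈ S ∧ x.2 a + x.1 = b

/-- In a brace, `γ(γ(c)(b) + c) = γ(c) ∘ γ(b)`. -/
theorem IsBrace.gamma_comp {A : Type*} [AddCommGroup A] {bmul : A → A → A} {gamma : A → A ≃+ A}
    (h : IsBrace bmul) (hg : ∀ a c : A, gamma a c = bmul c a + c) (a b c : A) :
    gamma (c + gamma c b) a = gamma c (gamma b a) := by
  obtain ⟨hadd, hassoc, -⟩ := h
  rw [show c + gamma c b = bmul b c + b + c by rw [hg]; abel, hg, hassoc, hg c, hg b, hadd]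
  abel

/-- In a brace, `γ(0)` is the identity. -/
theorem IsBrace.gamma_zero {A : Type*} [AddCommGroup A] {bmul : A → A → A} {gamma : A → A ≃+ A}
    (h : IsBrace bmul) (hg : ∀ a c : A, gamma a c = bmul c a + c) (a : A) :
    gamma 0 a = a := by
  have := h.gamma_comp hg a 0 0
  rw [map_zero, add_zero] at this
  exact ((gamma 0).injective this).symm

/-- In a brace, `γ(-γ(a)⁻¹(a)) = γ(a)⁻¹`. -/
theorem IsBrace.gamma_neg_symm {A : Type*} [AddCommGroup A] {bmul : A → A → A}
    {gamma : A → A ≃+ A} (h : IsBrace bmul) (hg : ∀ a c : A, gamma a c = bmul c a + c) (a c : A) :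
    gamma (-(gamma a).symm a) c = (gamma a).symm c := by
  have := h.gamma_comp hg c (-(gamma a).symm a) a
  rw [map_neg, AddEquiv.apply_symm_apply, add_neg_cancel, h.gamma_zero hg] at this
  rw [AddEquiv.eq_symm_apply, ← this]

/-- The graph of `γ` is a regular subgroup. -/
theorem IsBrace.isRegularSubgroup {A : Type*} [AddCommGroup A] {bmul : A → A → A}
    {gamma : A → A ≃+ A} (h : IsBrace bmul) (hg : ∀ a c : A, gamma a c = bmul c a + c) :
    IsRegularSubgroup {p : A × (A ≃+ A) | ∃ a : A, p = (a, gamma a)} := by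
  refine ⟨⟨⟨0, ?_⟩, ?_, ?_⟩, fun a b => ?_⟩
  · exact Prod.ext rfl (AddEquiv.ext fun a => (h.gamma_zero hg a).symm)
  · rintro _ ⟨c, rfl⟩ _ ⟨b, rfl⟩
    exact ⟨c + gamma c b, Prod.ext rfl (AddEquiv.ext fun a => (h.gamma_comp hg a b c).symm)⟩
  · rintro _ ⟨a, rfl⟩
    exact ⟨-(gamma a).symm a,
      Prod.ext rfl (AddEquiv.ext fun c => (h.gamma_neg_symm hg a c).symm)⟩
  · refine ⟨(_, gamma (b + gamma b (-(gamma a).symm a))), ⟨⟨_, rfl⟩, ?_⟩, ?_⟩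
    · dsimp only
      rw [h.gamma_comp hg, h.gamma_neg_symm hg, map_neg]
      abel
    · rintro _ ⟨⟨x, rfl⟩, hx⟩
      dsimp only at hx
      have hcomp := h.gamma_comp hg ((gamma a).symm a) a x
      rw [add_comm x, hx, AddEquiv.apply_symm_apply] at hcomp
      have : x = b + gamma b (-(gamma a).symm a) := by
        rw [map_neg, hcomp, ← hx]
        abel
      rw [← this]

/-- A regular subgroup, seen as the graph of `f`, defines a brace. -/
theorem IsRegularSubgroup.isBrace {A : Type*} [AddCommGroup A] {S : Set (A × (A ≃+ A))}
    {f : A → A ≃+ A} (hS : IsRegularSubgroup S) (hf : ∀ b : A, (b, f b) ∈ S)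
    (huniq : ∀ (b : A) (g : A ≃+ A), (b, g) ∈ S → g = f b) :
    IsBrace (fun a b => f b a - a) := by
  refine ⟨fun a b c => ?_, fun a b c => ?_, fun b => ?_⟩
  · simp only [map_add]
    abel
  · have hcomp : f (c + f c b) a = f c (f b a) :=
      (DFunLike.congr_fun (huniq _ _ (hS.1.2.1 _ (hf c) _ (hf b))) a).symm
    dsimp only
    rw [sub_add_cancel, add_comm (f c b), hcomp, map_sub]
    abel
  · simpa only [sub_add_cancel] using (f b).bijective

theorem stmt19 {A : Type*} [AddCommGroup A] :
    (∀ (bmul : A → A → A) (gamma : A → A ≃+ A),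
        IsBrace bmul → (∀ a c : A, gamma a c = bmul c a + c) →
        IsRegularSubgroup {p : A × (A ≃+ A) | ∃ a : A, p = (a, gamma a)}) ∧
    (∀ (S : Set (A × (A ≃+ A))) (f : A → A ≃+ A),
        IsRegularSubgroup S → (∀ b : A, (b, f b) ∈ S) →
        (∀ (b : A) (g : A ≃+ A), (b, g) ∈ S → g = f b) →
        IsBrace (fun a b => f b a - a)) := by
  exact ⟨fun _ _ h hg => h.isRegularSubgroup hg, fun _ _ hS hf huniq => hS.isBrace hf huniq⟩
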